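/- Let E be a real normed vector space, let x₀, x₁ ∈ E, let L ≥ 0 and V ≥ 0, and let v : E × ℝ → E be jointly L-Lipschitz (‖v(x,t) − v(x',t')‖ ≤ L(‖x − x'‖ + |t − t'|)) with uniformly bounded norm ‖v(x,t)‖ ≤ V for all x, t. Let N ≥ 1, Δt = 1/N, t_k = 1 − k·Δt, and define the backward Euler trajectory y₀ = x₁, y_{k+1} = y_k − Δt · v(y_k, t_k). Then, writing ε₀ = v(x₁, 1) − (x₁ − x₀) for the initial velocity error, the terminal generation error satisfies ‖y_N − x₀‖ ≤ ‖ε₀‖ + L·(V + 1)·(N − 1)/(2N). In particular, if the model is exact at the initial point (v(x₁, 1) = x₁ − x₀), then ‖y_N − x₀‖ ≤ L·(V + 1)/2, a bound proportional to the Lipschitz constant L of the velocity field. -/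

import Mathlib

/-- An explicit iteration with step `h` and velocities bounded by `V` drifts at most `k * h * V`
from its initial point in `k` steps. -/
theorem norm_sub_initial_le_of_step
    {E : Type*} [NormedAddCommGroup E] [NormedSpace ℝ E]
    {h V : ℝ} (hh : 0 ≤ h) {N : ℕ} {y w : ℕ → E} (hw : ∀ k < N, ‖w k‖ ≤ V)
    (hstep : ∀ k < N, y (k + 1) = y k - h • w k) :
    ∀ k ≤ N, ‖y k - y 0‖ ≤ k * h * V := by
  intro k
  induction k with
  | zero => simp
  | succ k ih =>
    intro hk
    calc ‖y (k + 1) - y 0‖ = ‖(y k - y 0) - h • w k‖ := by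
          rw [hstep k hk]; congr 1; abel
      _ ≤ ‖y k - y 0‖ + ‖h • w k‖ := norm_sub_le _ _
      _ ≤ k * h * V + h * V := by
          rw [norm_smul, Real.norm_of_nonneg hh]
          gcongr
          exacts [ih (by omega), hw k hk]
      _ = ((k + 1 : ℕ) : ℝ) * h * V := by push_cast; ring

/-- If the velocities of an explicit iteration with step `h` deviate from a constant velocity `w₀`
by at most `k * C` at step `k`, the iteration deviates from the straight line with velocity `w₀`
by at most `h * C * (k * (k - 1) / 2)`. -/
theorem norm_sub_line_le_of_step
    {E : Type*} [NormedAddCommGroup E] [NormedSpace ℝ E]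
    {h C : ℝ} (hh : 0 ≤ h) {N : ℕ} {y w : ℕ → E} {w₀ : E}
    (hw : ∀ k < N, ‖w k - w₀‖ ≤ k * C)
    (hstep : ∀ k < N, y (k + 1) = y k - h • w k) :
    ∀ k ≤ N, ‖y k - (y 0 - (k * h) • w₀)‖ ≤ h * C * (k * (k - 1) / 2) := by
  intro k
  induction k with
  | zero => simp
  | succ k ih =>
    intro hk
    calc ‖y (k + 1) - (y 0 - (((k + 1 : ℕ) : ℝ) * h) • w₀)‖
        = ‖(y k - (y 0 - (k * h) • w₀)) - h • (w k - w₀)‖ := by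
          rw [hstep k hk]; congr 1; push_cast; module
      _ ≤ ‖y k - (y 0 - (k * h) • w₀)‖ + ‖h • (w k - w₀)‖ := norm_sub_le _ _
      _ ≤ h * C * (k * (k - 1) / 2) + h * (k * C) := by
          rw [norm_smul, Real.norm_of_nonneg hh]
          gcongr
          exacts [ih (by omega), hw k hk]
      _ = h * C * (((k + 1 : ℕ) : ℝ) * (((k + 1 : ℕ) : ℝ) - 1) / 2) := by push_cast; ring

/-- **Trajectory Integration Error Bound.** If `v` is jointly `L`-Lipschitz and uniformly
bounded by `V`, then the terminal error of the backward Euler trajectory satisfies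
`‖y N - x₀‖ ≤ ‖ε₀‖ + L·(V+1)·(N-1)/(2N)` where `ε₀ = v (x₁, 1) - (x₁ - x₀)`; in particular,
if the model is exact at the initial point, `‖y N - x₀‖ ≤ L·(V+1)/2`. -/
theorem backward_euler_trajectory_error_bound
    {E : Type*} [NormedAddCommGroup E] [NormedSpace ℝ E]
    (x₀ x₁ : E) (L V : ℝ) (hL : 0 ≤ L) (hV : 0 ≤ V) (v : E × ℝ → E)
    (hlip : ∀ x x' : E, ∀ t t' : ℝ,
      ‖v (x, t) - v (x', t')‖ ≤ L * (‖x - x'‖ + |t - t'|))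
    (hbdd : ∀ x : E, ∀ t : ℝ, ‖v (x, t)‖ ≤ V)
    (N : ℕ) (hN : 1 ≤ N)
    (y : ℕ → E) (hy0 : y 0 = x₁)
    (hstep : ∀ k < N, y (k + 1) =
      y k - (1 / (N : ℝ)) • v (y k, 1 - (k : ℝ) * (1 / (N : ℝ)))) :
    ‖y N - x₀‖ ≤
        ‖v (x₁, 1) - (x₁ - x₀)‖ + L * (V + 1) * (((N : ℝ) - 1) / (2 * (N : ℝ))) ∧
      (v (x₁, 1) = x₁ - x₀ → ‖y N - x₀‖ ≤ L * (V + 1) / 2) := by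
  have hN_pos : (0 : ℝ) < N := by exact_mod_cast hN
  have hh : (0 : ℝ) ≤ 1 / (N : ℝ) := by positivity
  have hdrift := norm_sub_initial_le_of_step hh (fun k _ => hbdd _ _) hstep
  have hvel : ∀ k < N, ‖v (y k, 1 - (k : ℝ) * (1 / (N : ℝ))) - v (x₁, 1)‖ ≤
      k * (L * (V + 1) * (1 / (N : ℝ))) := by
    intro k hk
    have habs : |1 - (k : ℝ) * (1 / (N : ℝ)) - 1| = k * (1 / (N : ℝ)) := by
      rw [sub_right_comm, sub_self, zero_sub, abs_neg, abs_of_nonneg (by positivity)]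
    calc _ ≤ L * (‖y k - x₁‖ + |1 - (k : ℝ) * (1 / (N : ℝ)) - 1|) := hlip _ _ _ _
      _ ≤ L * (k * (1 / (N : ℝ)) * V + k * (1 / (N : ℝ))) := by
          rw [habs]
          gcongr
          exact hy0 ▸ hdrift k hk.le
      _ = _ := by ring
  have hline := norm_sub_line_le_of_step hh hvel hstep N le_rfl
  rw [hy0, mul_one_div_cancel hN_pos.ne', one_smul] at hline
  have hmain : ‖y N - x₀‖ ≤
      ‖v (x₁, 1) - (x₁ - x₀)‖ + L * (V + 1) * (((N : ℝ) - 1) / (2 * (N : ℝ))) := by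
    calc ‖y N - x₀‖ = ‖(y N - (x₁ - v (x₁, 1))) - (v (x₁, 1) - (x₁ - x₀))‖ := by
          congr 1; abel
      _ ≤ ‖y N - (x₁ - v (x₁, 1))‖ + ‖v (x₁, 1) - (x₁ - x₀)‖ := norm_sub_le _ _
      _ ≤ _ := by
          rw [add_comm]
          gcongr
          refine hline.trans_eq ?_
          field_simp
  refine ⟨hmain, fun hexact => hmain.trans ?_⟩
  rw [hexact, sub_self, norm_zero, zero_add, div_eq_mul_one_div (L * (V + 1)) 2]
  gcongr L * (V + 1) * ?_
  rw [div_le_div_iff₀ (by positivity) two_pos]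
  linarith
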